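/- Let n, d be positive integers with dn even and fix a constant γ > 0. For every i with 1 ≤ i ≤ i1 and every pairing P ∈ S_i, the number of type II switchings on P satisfies f_II(P) ≤ 16·i·(d−1)²·(d−2)·(d−3). -/

import Mathlib

/-!
Formalization of the pairing model of random `d`-regular (multi)graphs and of the
switchings used in the uniform sampler *REG* of Gao and Wormald,
"Uniform generation of random regular graphs".

Bins are elements of `Fin n`; each bin contains `d` points, so points are
elements of `Fin n × Fin d`.  A pairing is a perfect matching of the points,
modelled as a fixed-point-free involution on the points: the pairs of the
pairing are the orbits `{x, P.f x}`.
-/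

namespace Reg

abbrev Point (n d : ℕ) := Fin n × Fin d

/-- A pairing: a perfect matching of the `d * n` points, encoded as a
fixed-point-free involution.  The pairs are the 2-element sets `{x, f x}`. -/
structure Pairing (n d : ℕ) where
  f : Point n d → Point n d
  invol : ∀ x, f (f x) = x
  nofix : ∀ x, f x ≠ x

instance {n d : ℕ} : Finite (Pairing n d) :=
  Finite.of_injective (fun P => P.f) fun P Q h => by
    cases P; cases Q; congr

variable {n d : ℕ}

/-- The number of pairs of `P` with one point in bin `u` and one point in bin `v`
(for distinct bins `u ≠ v` this is the multiplicity of the edge `uv`). -/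
def mult (P : Pairing n d) (u v : Fin n) : ℕ :=
  (Finset.univ.filter fun a : Point n d => a.1 = u ∧ (P.f a).1 = v).card

/-- Two bins are adjacent if some pair of the pairing joins them. -/
def Adj (P : Pairing n d) (u v : Fin n) : Prop := u ≠ v ∧ 1 ≤ mult P u v

/-- The number of loops of `P` (pairs whose two points lie in the same bin). -/
def numLoops (P : Pairing n d) : ℕ :=
  (Finset.univ.filter fun a : Point n d => (P.f a).1 = a.1).card / 2

/-- The number of loops of `P` lying in bin `u`. -/
def loopsAt (P : Pairing n d) (u : Fin n) : ℕ :=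
  (Finset.univ.filter fun a : Point n d => a.1 = u ∧ (P.f a).1 = u).card / 2

/-- The number of (unordered) pairs of distinct bins joined by exactly `k` pairs of `P`,
i.e. the number of edges of multiplicity exactly `k`. -/
def edgesWithMult (P : Pairing n d) (k : ℕ) : ℕ :=
  (Finset.univ.filter fun q : Fin n × Fin n => q.1 < q.2 ∧ mult P q.1 q.2 = k).card

/-- `M1 = dn` as a real number. -/
noncomputable def M1R (n d : ℕ) : ℝ := (d : ℝ) * n

/-- `M2 = n d (d-1)` as a real number. -/
noncomputable def M2R (n d : ℕ) : ℝ := (n : ℝ) * d * ((d : ℝ) - 1)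

/-- `M3 = n d (d-1) (d-2)` as a real number. -/
noncomputable def M3R (n d : ℕ) : ℝ := (n : ℝ) * d * ((d : ℝ) - 1) * ((d : ℝ) - 2)

/-- `i1 = ⌊(1+γ)(d-1)²/4⌋`. -/
noncomputable def i1Nat (d : ℕ) (γ : ℝ) : ℕ := (⌊(1 + γ) * ((d : ℝ) - 1) ^ 2 / 4⌋).toNat

/-- The stratum `S_i` of the double-edge reduction phase: pairings with no loops,
every edge of multiplicity at most 2, and exactly `i` double edges. -/
def SD (n d i : ℕ) : Set (Pairing n d) :=
  {P | numLoops P = 0 ∧ (∀ u v : Fin n, u ≠ v → mult P u v ≤ 2) ∧ edgesWithMult P 2 = i}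

/-- `Φ1 = ⋃_{0 ≤ i ≤ m} S_i`. -/
def Phi1 (n d m : ℕ) : Set (Pairing n d) := {P | ∃ i ≤ m, P ∈ SD n d i}

/-- The labelled data (points 1–8) of a d-switching. -/
structure DSwitch (n d : ℕ) where
  p1 : Point n d
  p2 : Point n d
  p3 : Point n d
  p4 : Point n d
  p5 : Point n d
  p6 : Point n d
  p7 : Point n d
  p8 : Point n d

/-- The four target bin-pairs `u1u2, u1u3, v1v2, v1v3` of a d-switching. -/
def targets (s : DSwitch n d) : List (Fin n × Fin n) :=
  [(s.p1.1, s.p5.1), (s.p1.1, s.p7.1), (s.p2.1, s.p6.1), (s.p2.1, s.p8.1)]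

/-- `s` is a valid d-switching on `P`. -/
def IsDSwitch (P : Pairing n d) (s : DSwitch n d) : Prop :=
  P.f s.p1 = s.p2 ∧ P.f s.p3 = s.p4 ∧ P.f s.p5 = s.p6 ∧ P.f s.p7 = s.p8 ∧
  s.p1.1 = s.p3.1 ∧ s.p2.1 = s.p4.1 ∧ s.p1 ≠ s.p3 ∧
  mult P s.p1.1 s.p2.1 = 2 ∧ mult P s.p5.1 s.p6.1 = 1 ∧ mult P s.p7.1 s.p8.1 = 1 ∧
  [s.p1.1, s.p2.1, s.p5.1, s.p6.1, s.p7.1, s.p8.1].Pairwise (· ≠ ·)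

/-- The number of target bin-pairs of `s` joined by at least one pair of `P`. -/
def joinedCount (P : Pairing n d) (s : DSwitch n d) : ℕ :=
  (targets s).countP fun t => decide (1 ≤ mult P t.1 t.2)

/-- A type I switching: a d-switching creating at most one new double edge. -/
def IsTypeI (P : Pairing n d) (s : DSwitch n d) : Prop :=
  IsDSwitch P s ∧ (∀ t ∈ targets s, mult P t.1 t.2 ≤ 1) ∧ joinedCount P s ≤ 1

/-- A type I switching of class A: it creates no new double edge. -/
def IsTypeIA (P : Pairing n d) (s : DSwitch n d) : Prop := IsTypeI P s ∧ joinedCount P s = 0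

/-- A type I switching of class B: it creates exactly one new double edge. -/
def IsTypeIB (P : Pairing n d) (s : DSwitch n d) : Prop := IsTypeI P s ∧ joinedCount P s = 1

/-- The labelled data (points 1–12) of a type II switching. -/
structure DSwitch2 (n d : ℕ) extends DSwitch n d where
  p9 : Point n d
  p10 : Point n d
  p11 : Point n d
  p12 : Point n d

/-- A type II switching: a d-switching creating exactly two new double edges, both
incident with `u1` or both incident with `v1`, together with the labelling
`{9,10}, {11,12}` (with 9 and 12 in `u1`, resp. `v1`) of the two existing pairs
joining the two joined target bin-pairs. -/
def IsTypeII (P : Pairing n d) (s : DSwitch2 n d) : Prop :=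
  IsDSwitch P s.toDSwitch ∧ (∀ t ∈ targets s.toDSwitch, mult P t.1 t.2 ≤ 1) ∧
  P.f s.p9 = s.p10 ∧ P.f s.p11 = s.p12 ∧
  ((s.p9.1 = s.p1.1 ∧ s.p12.1 = s.p1.1 ∧
      ((s.p10.1 = s.p5.1 ∧ s.p11.1 = s.p7.1) ∨ (s.p10.1 = s.p7.1 ∧ s.p11.1 = s.p5.1)) ∧
      mult P s.p1.1 s.p5.1 = 1 ∧ mult P s.p1.1 s.p7.1 = 1 ∧
      mult P s.p2.1 s.p6.1 = 0 ∧ mult P s.p2.1 s.p8.1 = 0) ∨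
    (s.p9.1 = s.p2.1 ∧ s.p12.1 = s.p2.1 ∧
      ((s.p10.1 = s.p6.1 ∧ s.p11.1 = s.p8.1) ∨ (s.p10.1 = s.p8.1 ∧ s.p11.1 = s.p6.1)) ∧
      mult P s.p2.1 s.p6.1 = 1 ∧ mult P s.p2.1 s.p8.1 = 1 ∧
      mult P s.p1.1 s.p5.1 = 0 ∧ mult P s.p1.1 s.p7.1 = 0))

/-- Conjugating a pairing by a permutation of the points: the pairs of
`conj P τ` are the images under `τ` of the pairs of `P`. -/
def conj (P : Pairing n d) (τ : Equiv.Perm (Point n d)) : Pairing n d where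
  f := fun x => τ (P.f (τ.symm x))
  invol := by intro x; simp [P.invol]
  nofix := by
    intro x h
    refine P.nofix (τ.symm x) ?_
    have h3 := congrArg τ.symm h
    simpa using h3

/-- The permutation performing a d-switching: it replaces the pairs
`{1,2},{3,4},{5,6},{7,8}` by `{1,5},{3,7},{2,6},{4,8}`. -/
def dtau (s : DSwitch n d) : Equiv.Perm (Point n d) :=
  (Equiv.swap s.p4 s.p7).trans (Equiv.swap s.p2 s.p5)

/-- The pairing resulting from performing a d-switching. -/
def dResult (P : Pairing n d) (s : DSwitch n d) : Pairing n d := conj P (dtau s)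

/-- `f_I(P)`: the number of type I switchings on `P`. -/
noncomputable def fI (P : Pairing n d) : ℕ := Nat.card {s : DSwitch n d // IsTypeI P s}

/-- `f_II(P)`: the number of type II switchings on `P`. -/
noncomputable def fII (P : Pairing n d) : ℕ := Nat.card {s : DSwitch2 n d // IsTypeII P s}

/-- `b_A(P)`: the number of class A switchings from pairings in `Φ1` producing `P`. -/
noncomputable def bA (m : ℕ) (P : Pairing n d) : ℕ :=
  Nat.card {q : Pairing n d × DSwitch n d //
    q.1 ∈ Phi1 n d m ∧ IsTypeIA q.1 q.2 ∧ dResult q.1 q.2 = P}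

/-- `b_B(P)`: the number of class B switchings (of type I or type II) from
pairings in `Φ1` producing `P`. -/
noncomputable def bB (m : ℕ) (P : Pairing n d) : ℕ :=
  Nat.card {q : Pairing n d × DSwitch n d //
    q.1 ∈ Phi1 n d m ∧ IsTypeIB q.1 q.2 ∧ dResult q.1 q.2 = P} +
  Nat.card {q : Pairing n d × DSwitch2 n d //
    q.1 ∈ Phi1 n d m ∧ IsTypeII q.1 q.2 ∧ dResult q.1 q.2.toDSwitch = P}

/-- `B_D = ⌊(1+γ)(d-1)²/4⌋`. -/
noncomputable def BD (d : ℕ) (γ : ℝ) : ℕ := i1Nat d γ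

/-- `B_L = max(⌈log dn⌉, 4d)`. -/
noncomputable def BL (n d : ℕ) : ℕ := max (⌈Real.log ((d : ℝ) * n)⌉.toNat) (4 * d)

/-- `B_T = max(⌈log dn⌉, ⌈d³/n⌉)`. -/
noncomputable def BT (n d : ℕ) : ℕ :=
  max (⌈Real.log ((d : ℝ) * n)⌉.toNat) (⌈(d : ℝ) ^ 3 / (n : ℝ)⌉.toNat)

/-- The set `A` of pairings that are not initially rejected:
`D(P) ≤ B_D`, `L(P) ≤ B_L` and `T(P) ≤ B_T`. -/
def AccSet (n d : ℕ) (γ : ℝ) : Set (Pairing n d) :=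
  {P | edgesWithMult P 2 ≤ BD d γ ∧ numLoops P ≤ BL n d ∧ edgesWithMult P 3 ≤ BT n d}

/-- The stratum `S^L_i` of the loop reduction phase. -/
def SL (n d : ℕ) (γ : ℝ) (i : ℕ) : Set (Pairing n d) :=
  {P | numLoops P = i ∧ (∀ u : Fin n, loopsAt P u ≤ 1) ∧
    edgesWithMult P 2 ≤ BD d γ ∧ edgesWithMult P 3 ≤ BT n d ∧
    ∀ u v : Fin n, u ≠ v → mult P u v ≤ 3}

/-- The labelled data (points 1–6) of a type L switching. -/
structure LSwitch (n d : ℕ) where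
  q1 : Point n d
  q2 : Point n d
  q3 : Point n d
  q4 : Point n d
  q5 : Point n d
  q6 : Point n d

/-- `s` is a valid type L switching on `P`. -/
def IsLSwitch (P : Pairing n d) (s : LSwitch n d) : Prop :=
  P.f s.q1 = s.q2 ∧ s.q1.1 = s.q2.1 ∧
  P.f s.q3 = s.q4 ∧ P.f s.q5 = s.q6 ∧
  mult P s.q3.1 s.q4.1 = 1 ∧ mult P s.q5.1 s.q6.1 = 1 ∧
  [s.q1.1, s.q3.1, s.q4.1, s.q5.1, s.q6.1].Pairwise (· ≠ ·) ∧
  mult P s.q1.1 s.q3.1 = 0 ∧ mult P s.q1.1 s.q5.1 = 0 ∧ mult P s.q4.1 s.q6.1 = 0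

/-- The permutation performing a type L switching: it replaces the pairs
`{1,2},{3,4},{5,6}` by `{1,3},{2,5},{4,6}`. -/
def ltau (s : LSwitch n d) : Equiv.Perm (Point n d) :=
  (Equiv.swap s.q4 s.q5).trans (Equiv.swap s.q2 s.q3)

/-- The pairing resulting from performing a type L switching. -/
def lResult (P : Pairing n d) (s : LSwitch n d) : Pairing n d := conj P (ltau s)

/-- `f_L(P)`: the number of type L switchings on `P`. -/
noncomputable def fL (P : Pairing n d) : ℕ := Nat.card {s : LSwitch n d // IsLSwitch P s}

/-- `b_A^L(P)`: the number of type L switchings from pairings in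
`⋃_{0 ≤ j ≤ B_L} S^L_j` producing `P`. -/
noncomputable def bAL (γ : ℝ) (P : Pairing n d) : ℕ :=
  Nat.card {q : Pairing n d × LSwitch n d //
    (∃ j ≤ BL n d, q.1 ∈ SL n d γ j) ∧ IsLSwitch q.1 q.2 ∧ lResult q.1 q.2 = P}

/-- The stratum `S^T_i` of the triple-edge reduction phase. -/
def ST (n d : ℕ) (γ : ℝ) (i : ℕ) : Set (Pairing n d) :=
  {P | numLoops P = 0 ∧ edgesWithMult P 3 = i ∧ edgesWithMult P 2 ≤ BD d γ ∧
    ∀ u v : Fin n, u ≠ v → mult P u v ≤ 3}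

/-- The labelled data (points 1–12) of a type T switching. -/
structure TSwitch (n d : ℕ) where
  r1 : Point n d
  r2 : Point n d
  r3 : Point n d
  r4 : Point n d
  r5 : Point n d
  r6 : Point n d
  r7 : Point n d
  r8 : Point n d
  r9 : Point n d
  r10 : Point n d
  r11 : Point n d
  r12 : Point n d

/-- `s` is a valid type T switching on `P`. -/
def IsTSwitch (P : Pairing n d) (s : TSwitch n d) : Prop :=
  P.f s.r1 = s.r2 ∧ P.f s.r3 = s.r4 ∧ P.f s.r5 = s.r6 ∧
  P.f s.r7 = s.r8 ∧ P.f s.r9 = s.r10 ∧ P.f s.r11 = s.r12 ∧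
  s.r1.1 = s.r3.1 ∧ s.r3.1 = s.r5.1 ∧ s.r2.1 = s.r4.1 ∧ s.r4.1 = s.r6.1 ∧
  s.r1 ≠ s.r3 ∧ s.r3 ≠ s.r5 ∧ s.r1 ≠ s.r5 ∧
  mult P s.r1.1 s.r2.1 = 3 ∧
  mult P s.r7.1 s.r8.1 = 1 ∧ mult P s.r9.1 s.r10.1 = 1 ∧ mult P s.r11.1 s.r12.1 = 1 ∧
  [s.r1.1, s.r2.1, s.r7.1, s.r8.1, s.r9.1, s.r10.1, s.r11.1, s.r12.1].Pairwise (· ≠ ·) ∧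
  mult P s.r1.1 s.r7.1 = 0 ∧ mult P s.r1.1 s.r9.1 = 0 ∧ mult P s.r1.1 s.r11.1 = 0 ∧
  mult P s.r2.1 s.r8.1 = 0 ∧ mult P s.r2.1 s.r10.1 = 0 ∧ mult P s.r2.1 s.r12.1 = 0

/-- The permutation performing a type T switching: it replaces the pairs
`{1,2},{3,4},{5,6},{7,8},{9,10},{11,12}` by `{1,7},{2,8},{3,9},{4,10},{5,11},{6,12}`. -/
def ttau (s : TSwitch n d) : Equiv.Perm (Point n d) :=
  ((Equiv.swap s.r2 s.r7).trans (Equiv.swap s.r4 s.r9)).trans (Equiv.swap s.r6 s.r11)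

/-- The pairing resulting from performing a type T switching. -/
def tResult (P : Pairing n d) (s : TSwitch n d) : Pairing n d := conj P (ttau s)

/-- `f_T(P)`: the number of type T switchings on `P`. -/
noncomputable def fT (P : Pairing n d) : ℕ := Nat.card {s : TSwitch n d // IsTSwitch P s}

/-- `b_A^T(P)`: the number of type T switchings from pairings in
`⋃_{0 ≤ j ≤ B_T} S^T_j` producing `P`. -/
noncomputable def bAT (γ : ℝ) (P : Pairing n d) : ℕ :=
  Nat.card {q : Pairing n d × TSwitch n d //
    (∃ j ≤ BT n d, q.1 ∈ ST n d γ j) ∧ IsTSwitch q.1 q.2 ∧ tResult q.1 q.2 = P}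

/-- The endpoints of the pair of `P` containing the point `a` lie in bins
`w1, w2` such that `u, v, w1, w2` are four distinct bins, `w1` is adjacent to `u`
and `w2` is adjacent to `v`. -/
def GoodPair (u v : Fin n) (P : Pairing n d) (a : Point n d) : Prop :=
  ∃ w1 w2 : Fin n,
    ((w1 = a.1 ∧ w2 = (P.f a).1) ∨ (w1 = (P.f a).1 ∧ w2 = a.1)) ∧
    [u, v, w1, w2].Pairwise (· ≠ ·) ∧ Adj P w1 u ∧ Adj P w2 v

/-- Four times the number of unordered pairs `{e, e'}` of distinct pairs of `P`
joining the same two distinct bins: ordered pairs of points `(a, b)` lying in a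
common bin whose mates also lie in a common (different) bin. -/
def parallelOrdered (P : Pairing n d) : ℕ :=
  (Finset.univ.filter fun q : Point n d × Point n d =>
    q.1.1 = q.2.1 ∧ (P.f q.1).1 = (P.f q.2).1 ∧ q.1.1 ≠ (P.f q.1).1 ∧ q.1 ≠ q.2).card

/-- Twice the number of unordered pairs of two distinct double edges of `P`
sharing a common bin (double edges being recorded as ordered bin-pairs `(u,v)`
with `u < v`). -/
def doubleSharedOrdered (P : Pairing n d) : ℕ :=
  (Finset.univ.filter fun q : (Fin n × Fin n) × (Fin n × Fin n) =>
    q.1.1 < q.1.2 ∧ q.2.1 < q.2.2 ∧ mult P q.1.1 q.1.2 = 2 ∧ mult P q.2.1 q.2.2 = 2 ∧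
    q.1 ≠ q.2 ∧
    (q.1.1 = q.2.1 ∨ q.1.1 = q.2.2 ∨ q.1.2 = q.2.1 ∨ q.1.2 = q.2.2)).card

/-- `m̄_I(i) = 4 i (M1 - 4i)²`. -/
noncomputable def mbarIp (nR dR : ℝ) (i : ℕ) : ℝ := 4 * i * (dR * nR - 4 * i) ^ 2

/-- `m̄_II(i) = 16 i (d-1)² (d-2) (d-3)`. -/
noncomputable def mbarIIp (dR : ℝ) (i : ℕ) : ℝ :=
  16 * i * (dR - 1) ^ 2 * (dR - 2) * (dR - 3)

/-- `m̲_A(i) = M2² - M2 (d-1) (16 i + 3d² + d + 6)`. -/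
noncomputable def mAp (nR dR : ℝ) (i : ℕ) : ℝ :=
  (nR * dR * (dR - 1)) ^ 2 - nR * dR * (dR - 1) * (dR - 1) * (16 * i + 3 * dR ^ 2 + dR + 6)

/-- `m̲_B(i) = 16 i (d-2) M2 - 16 i d (8 i d + 9 d² + 3 d³)`. -/
noncomputable def mBp (nR dR : ℝ) (i : ℕ) : ℝ :=
  16 * i * (dR - 2) * (nR * dR * (dR - 1)) - 16 * i * dR * (8 * i * dR + 9 * dR ^ 2 + 3 * dR ^ 3)

/-- The system of equations (18)–(21) of the paper determining the type
probabilities `ρ_I, ρ_II` and the (scaled) expected numbers of visits `x_j`,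
together with the positivity requirement on the `x_j`. -/
def Sys (nR dR ε : ℝ) (m : ℕ) (x ρI ρII : ℕ → ℝ) : Prop :=
  (∀ j ≤ m, 0 < x j) ∧
  (∀ i : ℕ, 1 ≤ i → i ≤ m → ρI i = 1 - ε) ∧
  ρI 0 = 0 ∧ ρII 0 = 0 ∧ ρII m = 0 ∧
  (∀ j : ℕ, 1 ≤ j → j + 1 ≤ m →
    x j = 1 + x (j + 1) * ρI (j + 1) * mAp nR dR j / mbarIp nR dR (j + 1)
        + x j * ρI j * mBp nR dR j / mbarIp nR dR j) ∧
  (x m = 1 + x m * ρI m * mBp nR dR m / mbarIp nR dR m) ∧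
  (x 0 = 1 + x 1 * ρI 1 * mAp nR dR 0 / mbarIp nR dR 1) ∧
  (∀ j : ℕ, j + 1 ≤ m →
    ρII j = ρI (j + 1) * (x (j + 1) / x j) * (mbarIIp dR j / mbarIp nR dR (j + 1)))

/-- The explicit unique positive root `x(d)`. -/
noncomputable def xd (dR : ℝ) : ℝ :=
  (7 / 2) * dR - 7 / 2 + 5 / dR +
    (1 / (2 * dR)) * Real.sqrt (65 * dR ^ 4 - 210 * dR ^ 3 + 461 * dR ^ 2 - 412 * dR + 196)

theorem mult_comm (P : Pairing n d) (u v : Fin n) : mult P u v = mult P v u := by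
  refine Finset.card_bij' (fun a _ => P.f a) (fun a _ => P.f a) ?_ ?_ ?_ ?_ <;>
    simp +contextual [P.invol]

/-- The points of bin `w`. -/
def bin (d : ℕ) (w : Fin n) : Finset (Point n d) := Finset.univ.filter fun x => x.1 = w

theorem card_bin (w : Fin n) : (bin d w).card = d := by
  have h : bin d w = {w} ×ˢ Finset.univ := by
    ext ⟨u, k⟩
    simp [bin, eq_comm]
  simp [h]

/-- The points lying on a double edge. -/
def doublePoints (P : Pairing n d) : Finset (Point n d) :=
  Finset.univ.filter fun q => q.1 ≠ (P.f q).1 ∧ mult P q.1 (P.f q).1 = 2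

/-- The points in the bin of `q` whose mates share a bin with the mate of `q`. -/
def partners (P : Pairing n d) (q : Point n d) : Finset (Point n d) :=
  Finset.univ.filter fun x => x.1 = q.1 ∧ (P.f x).1 = (P.f q).1

/-- The points in the bin of `q` whose mates do not share a bin with the mate of `q`. -/
def others (P : Pairing n d) (q : Point n d) : Finset (Point n d) :=
  Finset.univ.filter fun x => x.1 = q.1 ∧ (P.f x).1 ≠ (P.f q).1

theorem card_partners (P : Pairing n d) (q : Point n d) :
    (partners P q).card = mult P q.1 (P.f q).1 := rfl

theorem card_partners_add_card_others (P : Pairing n d) (q : Point n d) :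
    (partners P q).card + (others P q).card = d := by
  have h := Finset.card_filter_add_card_filter_not (s := bin d q.1)
    (fun x => (P.f x).1 = (P.f q).1)
  rw [card_bin] at h
  simpa only [partners, others, bin, Finset.filter_filter] using h

theorem card_ordered_double_edges (P : Pairing n d) :
    (Finset.univ.filter fun q : Fin n × Fin n => q.1 ≠ q.2 ∧ mult P q.1 q.2 = 2).card
      ≤ 2 * edgesWithMult P 2 := by
  set E := Finset.univ.filter fun q : Fin n × Fin n => q.1 < q.2 ∧ mult P q.1 q.2 = 2 with hE
  have hsub : (Finset.univ.filter fun q : Fin n × Fin n => q.1 ≠ q.2 ∧ mult P q.1 q.2 = 2)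
      ⊆ E ∪ E.image Prod.swap := by
    rintro ⟨u, v⟩ h
    simp only [Finset.mem_filter, Finset.mem_univ, true_and] at h
    rcases lt_or_gt_of_ne h.1 with huv | huv
    · exact Finset.mem_union_left _ (by simp [hE, huv, h.2])
    · refine Finset.mem_union_right _ (Finset.mem_image.2 ⟨(v, u), ?_, rfl⟩)
      simp [hE, huv, mult_comm P v u, h.2]
  have h1 := Finset.card_le_card hsub
  have h2 := Finset.card_union_le E (E.image Prod.swap)
  have h3 : (E.image Prod.swap).card ≤ E.card := Finset.card_image_le
  change _ ≤ 2 * E.card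
  omega

theorem card_doublePoints_le (P : Pairing n d) :
    (doublePoints P).card ≤ 4 * edgesWithMult P 2 := by
  have h := Finset.card_le_mul_card_image_of_maps_to (s := doublePoints P)
    (t := Finset.univ.filter fun q : Fin n × Fin n => q.1 ≠ q.2 ∧ mult P q.1 q.2 = 2)
    (f := fun q => (q.1, (P.f q).1)) (by simp [doublePoints]) 2 (by
      rintro ⟨u, v⟩ huv
      simp only [Finset.mem_filter, Finset.mem_univ, true_and] at huv
      rw [← huv.2]
      refine Finset.card_le_card fun x hx => ?_
      simp only [Finset.mem_filter, Finset.mem_univ, true_and, Prod.mk.injEq] at hx ⊢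
      exact hx.2)
  have := card_ordered_double_edges P
  omega

theorem card_sigma_le_mul {α β : Type*} (s : Finset α) (t : α → Finset β) {m k : ℕ}
    (hs : s.card ≤ m) (ht : ∀ a ∈ s, (t a).card ≤ k) :
    (s.sigma fun a => t a).card ≤ m * k := by
  rw [Finset.card_sigma]
  refine (Finset.sum_le_card_nsmul s _ k ht).trans ?_
  simpa using Nat.mul_le_mul_right k hs

/-- Points `q₁, q₃, a, b` such that `q₁, q₃` are the points of a double edge in a common bin and
`a ≠ b` are further points of that bin. -/
def starData (P : Pairing n d) :
    Finset (Σ _ : (Σ _ : (Σ _ : Point n d, Point n d), Point n d), Point n d) :=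
  (((doublePoints P).sigma fun q => (partners P q).erase q).sigma
    fun x => others P x.1).sigma fun x => (others P x.1.1).erase x.2

/-- Points `q₁, q₃, a, b` as in `starData`, together with a point `q₅` sharing a bin with the mate
of `a` and a point `q₇` sharing a bin with the mate of `b`. -/
def switchData (P : Pairing n d) :
    Finset (Σ _ : (Σ _ : (Σ _ : (Σ _ : (Σ _ : Point n d, Point n d), Point n d), Point n d),
      Point n d), Point n d) :=
  ((starData P).sigma fun x => (bin d (P.f x.1.2).1).erase (P.f x.1.2)).sigma
    fun x => (bin d (P.f x.1.2).1).erase (P.f x.1.2)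

theorem card_starData_le (P : Pairing n d) :
    (starData P).card ≤ 4 * edgesWithMult P 2 * 1 * (d - 2) * (d - 3) := by
  have hpart : ∀ q ∈ doublePoints P, (partners P q).card = 2 := fun q hq => by
    rw [card_partners]
    exact (Finset.mem_filter.1 hq).2.2
  have hoth : ∀ q ∈ doublePoints P, (others P q).card = d - 2 := fun q hq => by
    have := card_partners_add_card_others P q
    have := hpart q hq
    omega
  refine card_sigma_le_mul _ _ (card_sigma_le_mul _ _ (card_sigma_le_mul _ _
    (card_doublePoints_le P) ?_) ?_) ?_
  · intro q hq
    rw [Finset.card_erase_of_mem (by simp [partners]), hpart q hq]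
  · intro x hx
    exact (hoth _ (Finset.mem_sigma.1 hx).1).le
  · intro x hx
    obtain ⟨hx1, hx2⟩ := Finset.mem_sigma.1 hx
    rw [Finset.card_erase_of_mem hx2, hoth _ (Finset.mem_sigma.1 hx1).1]
    omega

theorem card_switchData_le (P : Pairing n d) :
    (switchData P).card ≤ 4 * edgesWithMult P 2 * 1 * (d - 2) * (d - 3) * (d - 1) * (d - 1) := by
  have hbin : ∀ y : Point n d, ((bin d y.1).erase y).card ≤ d - 1 := fun y => by
    rw [Finset.card_erase_of_mem (by simp [bin]), card_bin]
  exact card_sigma_le_mul _ _ (card_sigma_le_mul _ _ (card_starData_le P)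
    fun _ _ => hbin _) fun _ _ => hbin _

theorem mem_switchData {P : Pairing n d} {q1 q3 a b q5 q7 : Point n d} :
    (⟨⟨⟨⟨⟨q1, q3⟩, a⟩, b⟩, q5⟩, q7⟩ : Σ _ : (Σ _ : (Σ _ : (Σ _ : (Σ _ : Point n d, Point n d),
      Point n d), Point n d), Point n d), Point n d) ∈ switchData P ↔
    (q1.1 ≠ (P.f q1).1 ∧ mult P q1.1 (P.f q1).1 = 2) ∧
    (q3 ≠ q1 ∧ q3.1 = q1.1 ∧ (P.f q3).1 = (P.f q1).1) ∧
    (a.1 = q1.1 ∧ (P.f a).1 ≠ (P.f q1).1) ∧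
    (b ≠ a ∧ b.1 = q1.1 ∧ (P.f b).1 ≠ (P.f q1).1) ∧
    (q5 ≠ P.f a ∧ q5.1 = (P.f a).1) ∧ (q7 ≠ P.f b ∧ q7.1 = (P.f b).1) := by
  simp only [switchData, starData, Finset.mem_sigma, Finset.mem_erase, doublePoints, partners,
    others, bin, Finset.mem_filter, Finset.mem_univ, true_and, and_assoc]

/-- The type II switching with centre `u1` (if `c`) or `v1` (otherwise) determined by an element
of `switchData`; `e` selects the labelling of the two existing pairs. -/
def decode (P : Pairing n d) (c e : Bool)
    (x : Σ _ : (Σ _ : (Σ _ : (Σ _ : (Σ _ : Point n d, Point n d), Point n d), Point n d),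
      Point n d), Point n d) : DSwitch2 n d :=
  let q1 := x.1.1.1.1.1
  let q3 := x.1.1.1.1.2
  let a := x.1.1.1.2
  let b := x.1.1.2
  let q5 := x.1.2
  let q7 := x.2
  let s : DSwitch n d :=
    if c then ⟨q1, P.f q1, q3, P.f q3, q5, P.f q5, q7, P.f q7⟩
    else ⟨P.f q1, q1, P.f q3, q3, P.f q5, q5, P.f q7, q7⟩
  if e then ⟨s, a, P.f a, P.f b, b⟩ else ⟨s, b, P.f b, P.f a, a⟩

/-- The conditions on the centre of a type II switching put the data in `switchData`. -/
theorem mem_switchData_of_bins_ne {P : Pairing n d} {q1 q3 a b q5 q7 : Point n d}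
    (h31 : q3.1 = q1.1) (hf31 : (P.f q3).1 = (P.f q1).1) (hne : q3 ≠ q1)
    (hm : mult P q1.1 (P.f q1).1 = 2) (ha : a.1 = q1.1) (hb : b.1 = q1.1)
    (h5 : q5.1 = (P.f a).1) (h7 : q7.1 = (P.f b).1) (h12 : q1.1 ≠ (P.f q1).1)
    (h16 : q1.1 ≠ (P.f q5).1) (h18 : q1.1 ≠ (P.f q7).1) (h25 : (P.f q1).1 ≠ q5.1)
    (h27 : (P.f q1).1 ≠ q7.1) (h57 : q5.1 ≠ q7.1) :
    (⟨⟨⟨⟨⟨q1, q3⟩, a⟩, b⟩, q5⟩, q7⟩ : Σ _ : (Σ _ : (Σ _ : (Σ _ : (Σ _ : Point n d, Point n d),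
      Point n d), Point n d), Point n d), Point n d) ∈ switchData P := by
  refine mem_switchData.2 ⟨⟨h12, hm⟩, ⟨hne, h31, hf31⟩, ⟨ha, fun h => h25 (h5.trans h).symm⟩,
    ⟨?_, hb, fun h => h27 (h7.trans h).symm⟩, ⟨?_, h5⟩, ⟨?_, h7⟩⟩
  · rintro rfl
    exact h57 (h5.trans h7.symm)
  · rintro rfl
    exact h16 (by rw [P.invol, ha])
  · rintro rfl
    exact h18 (by rw [P.invol, hb])

theorem IsTypeII.exists_decode {P : Pairing n d} {s : DSwitch2 n d} (h : IsTypeII P s) :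
    ∃ c e, ∃ x ∈ switchData P, decode P c e x = s := by
  obtain ⟨⟨p1, p2, p3, p4, p5, p6, p7, p8⟩, p9, p10, p11, p12⟩ := s
  obtain ⟨⟨h12, h34, h56, h78, h13, h24, hne, hm, -, -, hpw⟩, -, h910, h1112, h⟩ := h
  dsimp only at *
  subst h12 h34 h56 h78 h910 h1112
  simp only [List.pairwise_cons, List.mem_cons, List.not_mem_nil, or_false, forall_eq_or_imp,
    forall_eq] at hpw
  obtain ⟨⟨n12, n15, n16, n17, n18⟩, ⟨n25, n26, n27, n28⟩, ⟨n56, n57, n58⟩, ⟨n67, n68⟩, n78, -⟩ :=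
    hpw
  have hne2 : P.f p3 ≠ P.f p1 := fun h => hne (by rw [← P.invol p1, ← h, P.invol])
  rcases h with ⟨h9, h12, h | h, -⟩ | ⟨h9, h12, h | h, -⟩
  · exact ⟨true, true, _, mem_switchData_of_bins_ne (q3 := p3) (a := p9) (b := P.f p11)
      h13.symm h24.symm hne.symm hm h9 h12 h.1.symm (by rw [P.invol, h.2]) n12 n16 n18 n25 n27 n57,
      by simp [decode, P.invol]⟩
  · exact ⟨true, false, _, mem_switchData_of_bins_ne (q3 := p3) (a := P.f p11) (b := p9)
      h13.symm h24.symm hne.symm hm h12 h9 (by rw [P.invol, h.2]) h.1.symm n12 n16 n18 n25 n27 n57,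
      by simp [decode, P.invol]⟩
  · refine ⟨false, true, _, mem_switchData_of_bins_ne (q1 := P.f p1) (q3 := P.f p3) (a := p9)
      (b := P.f p11) (q5 := P.f p5) (q7 := P.f p7) h24.symm (by simp [P.invol, h13]) hne2
      (by rw [P.invol, mult_comm, hm]) h9 h12 h.1.symm (by rw [P.invol, h.2]) ?_ ?_ ?_ ?_ ?_ n68,
      by simp [decode, P.invol]⟩ <;> simp only [P.invol] <;> first | assumption | (symm; assumption)
  · refine ⟨false, false, _, mem_switchData_of_bins_ne (q1 := P.f p1) (q3 := P.f p3) (a := P.f p11)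
      (b := p9) (q5 := P.f p5) (q7 := P.f p7) h24.symm (by simp [P.invol, h13]) hne2
      (by rw [P.invol, mult_comm, hm]) h12 h9 (by rw [P.invol, h.2]) h.1.symm ?_ ?_ ?_ ?_ ?_ n68,
      by simp [decode, P.invol]⟩ <;> simp only [P.invol] <;> first | assumption | (symm; assumption)

theorem fII_le (P : Pairing n d) : fII P ≤ 4 * (switchData P).card := by
  classical
  have hsub : {s | IsTypeII P s} ⊆
      ((((Finset.univ : Finset (Bool × Bool)) ×ˢ switchData P).image
        fun y => decode P y.1.1 y.1.2 y.2 : Finset (DSwitch2 n d)) : Set (DSwitch2 n d)) := by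
    intro s hs
    obtain ⟨c, e, x, hx, rfl⟩ := hs.exists_decode
    exact Finset.mem_coe.2 (Finset.mem_image.2 ⟨((c, e), x), by simpa using hx, rfl⟩)
  calc fII P = Set.ncard {s | IsTypeII P s} := rfl
    _ ≤ _ := Set.ncard_le_ncard hsub (Finset.finite_toSet _)
    _ = _ := Set.ncard_coe_finset _
    _ ≤ _ := Finset.card_image_le
    _ = 4 * (switchData P).card := by simp [Finset.card_product]

/-- For every `1 ≤ i ≤ i1` and every pairing `P ∈ S_i`, the number of type II
switchings on `P` satisfies `f_II(P) ≤ 16 i (d-1)² (d-2) (d-3)`. -/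
theorem stmt_1 (n d : ℕ) (hn : 0 < n) (hd : 0 < d) (he : Even (d * n))
    (γ : ℝ) (hγ : 0 < γ) (i : ℕ) (hi1 : 1 ≤ i) (hi2 : i ≤ i1Nat d γ)
    (P : Pairing n d) (hP : P ∈ SD n d i) :
    (fII P : ℝ) ≤ 16 * i * ((d : ℝ) - 1) ^ 2 * ((d : ℝ) - 2) * ((d : ℝ) - 3) := by
  obtain ⟨-, -, hE⟩ := hP
  have key : fII P ≤ 16 * i * (d - 1) ^ 2 * (d - 2) * (d - 3) := by
    refine (fII_le P).trans ((Nat.mul_le_mul_left 4 (card_switchData_le P)).trans (le_of_eq ?_))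
    rw [hE]
    ring
  have keyR : (fII P : ℝ) ≤ ((16 * i * (d - 1) ^ 2 * (d - 2) * (d - 3) : ℕ) : ℝ) := by
    exact_mod_cast key
  refine keyR.trans (le_of_eq ?_)
  rcases lt_or_ge d 3 with h | h
  · interval_cases d <;> simp
  · push_cast [Nat.cast_sub (show 1 ≤ d by omega), Nat.cast_sub (show 2 ≤ d by omega),
      Nat.cast_sub h]
    ring

end Reg
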